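/- Let γ = (ξ,η) ∈ 𝒢 and let K, L, N, T ∈ ℕ satisfy C(L+1,2) < T ≤ C(L+2,2) and L < K ≤ N ≤ min{2K−L, (3K+2)/2}, and let Q ∈ I^{(γ,T)}_N. Then one can write Q = Σ_{j=0}^{2} X_j^{N−K}·Q_j for polynomials Q₀, Q₁, Q₂ ∈ I^{(γ,T)}_K satisfying 𝓛(Q₀)+𝓛(Q₁)+𝓛(Q₂) ≤ c₃(γ)^K·(64K)^T·𝓛(Q), where c₃(γ) = c₁(−γ)·c₂(γ) = (2+|ξ|+|η|⁻¹)·max{1,|ξ|,|η|}. -/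

import Mathlib

open MvPolynomial

/-- The derivation `𝒟 = X₀·∂/∂X₁ + X₂·∂/∂X₂` of `ℂ[X₀,X₁,X₂]`. -/
noncomputable def DD : MvPolynomial (Fin 3) ℂ → MvPolynomial (Fin 3) ℂ :=
  fun P => X 0 * pderiv 1 P + X 2 * pderiv 2 P

/-- The norm of a polynomial: the max of the absolute values of its coefficients. -/
noncomputable def pnorm (P : MvPolynomial (Fin 3) ℂ) : ℝ :=
  ((P.support.sup fun v => ‖P.coeff v‖₊ : NNReal) : ℝ)

/-- The length of a polynomial: the sum of the absolute values of its coefficients. -/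
noncomputable def plen (P : MvPolynomial (Fin 3) ℂ) : ℝ :=
  ∑ v ∈ P.support, ‖P.coeff v‖

/-- The automorphism `τ_γ` of `ℂ[X₀,X₁,X₂]`, `τ_γ(P)(X₀,X₁,X₂) = P(X₀, ξX₀+X₁, ηX₂)`. -/
noncomputable def tauG (ξ η : ℂ) : MvPolynomial (Fin 3) ℂ →ₐ[ℂ] MvPolynomial (Fin 3) ℂ :=
  aeval ![X 0, C ξ * X 0 + X 1, C η * X 2]

/-- The ideal `I^{(γ,T)}` generated by the homogeneous polynomials all of whose
derivatives `𝒟^i P`, `0 ≤ i < T`, vanish at `(1,ξ,η)`. -/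
noncomputable def Igam (ξ η : ℂ) (T : ℕ) : Ideal (MvPolynomial (Fin 3) ℂ) :=
  Ideal.span {P | (∃ d, P.IsHomogeneous d) ∧ ∀ i < T, eval ![1, ξ, η] (DD^[i] P) = 0}

/-! ### The length of a polynomial -/

lemma plen_eq_sum_of_support_subset {P : MvPolynomial (Fin 3) ℂ} {s : Finset (Fin 3 →₀ ℕ)}
    (h : P.support ⊆ s) : plen P = ∑ v ∈ s, ‖P.coeff v‖ :=
  Finset.sum_subset h fun v _ hv => by simp [notMem_support_iff.mp hv]

lemma plen_nonneg (P : MvPolynomial (Fin 3) ℂ) : 0 ≤ plen P :=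
  Finset.sum_nonneg fun _ _ => norm_nonneg _

@[simp] lemma plen_zero : plen 0 = 0 := by simp [plen]

lemma plen_monomial (v : Fin 3 →₀ ℕ) (c : ℂ) : plen (monomial v c) = ‖c‖ := by
  rw [plen_eq_sum_of_support_subset (s := {v}) support_monomial_subset]
  simp

lemma plen_add_le (P Q : MvPolynomial (Fin 3) ℂ) : plen (P + Q) ≤ plen P + plen Q := by
  classical
  rw [plen_eq_sum_of_support_subset (support_add (p := P) (q := Q)),
    plen_eq_sum_of_support_subset (P := P) (Finset.subset_union_left (s₂ := Q.support)),
    plen_eq_sum_of_support_subset (P := Q) (Finset.subset_union_right (s₁ := P.support)),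
    ← Finset.sum_add_distrib]
  exact Finset.sum_le_sum fun v _ => by simpa using norm_add_le _ _

lemma plen_neg (P : MvPolynomial (Fin 3) ℂ) : plen (-P) = plen P := by
  simp [plen]

lemma plen_sub_le (P Q : MvPolynomial (Fin 3) ℂ) : plen (P - Q) ≤ plen P + plen Q := by
  simpa [sub_eq_add_neg, plen_neg] using plen_add_le P (-Q)

lemma plen_sum_le {ι : Type*} (s : Finset ι) (f : ι → MvPolynomial (Fin 3) ℂ) :
    plen (∑ i ∈ s, f i) ≤ ∑ i ∈ s, plen (f i) :=
  Finset.le_sum_of_subadditive plen plen_zero.le plen_add_le s f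

lemma plen_mul_le (P Q : MvPolynomial (Fin 3) ℂ) : plen (P * Q) ≤ plen P * plen Q := by
  have h : P * Q = ∑ u ∈ P.support, ∑ v ∈ Q.support,
      monomial (u + v) (P.coeff u * Q.coeff v) := by
    conv_lhs => rw [P.as_sum, Q.as_sum, Finset.sum_mul_sum]
    simp [monomial_mul]
  rw [h, show plen P * plen Q = ∑ u ∈ P.support, ∑ v ∈ Q.support, ‖P.coeff u‖ * ‖Q.coeff v‖ from
    Finset.sum_mul_sum _ _ _ _]
  refine (plen_sum_le _ _).trans (Finset.sum_le_sum fun u _ => ?_)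
  refine (plen_sum_le _ _).trans (Finset.sum_le_sum fun v _ => ?_)
  rw [plen_monomial, norm_mul]

lemma plen_C (c : ℂ) : plen (C c) = ‖c‖ := plen_monomial 0 c

lemma plen_X (i : Fin 3) : plen (X i) = 1 := by
  rw [X, plen_monomial, norm_one]

lemma plen_C_mul_le (c : ℂ) (P : MvPolynomial (Fin 3) ℂ) : plen (C c * P) ≤ ‖c‖ * plen P := by
  simpa [plen_C] using plen_mul_le (C c) P

lemma plen_pow_le (P : MvPolynomial (Fin 3) ℂ) (n : ℕ) : plen (P ^ n) ≤ plen P ^ n := by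
  induction n with
  | zero => simpa using (plen_C 1).le
  | succ n ih =>
    rw [pow_succ, pow_succ]
    exact (plen_mul_le _ _).trans (mul_le_mul_of_nonneg_right ih (plen_nonneg P))

lemma plen_X_pow_mul_le (i : Fin 3) (n : ℕ) (P : MvPolynomial (Fin 3) ℂ) :
    plen (X i ^ n * P) ≤ plen P := by
  have h := plen_pow_le (X i) n
  rw [plen_X, one_pow] at h
  exact (plen_mul_le _ _).trans (mul_le_of_le_one_left (plen_nonneg P) h)

lemma degree_fin_three (v : Fin 3 →₀ ℕ) : v.degree = v 0 + v 1 + v 2 := by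
  rw [Finsupp.degree_eq_sum, Fin.sum_univ_three]

lemma sum_eq_of_mem_support {P : MvPolynomial (Fin 3) ℂ} {n : ℕ} (hP : P.IsHomogeneous n)
    {v : Fin 3 →₀ ℕ} (hv : v ∈ P.support) : v 0 + v 1 + v 2 = n := by
  rw [← degree_fin_three, Finsupp.degree_eq_weight_one]
  exact hP (mem_support_iff.mp hv)

lemma norm_eval_le {P : MvPolynomial (Fin 3) ℂ} {n : ℕ} (hP : P.IsHomogeneous n) {x : Fin 3 → ℂ}
    {B : ℝ} (hB : ∀ i, ‖x i‖ ≤ B) : ‖eval x P‖ ≤ B ^ n * plen P := by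
  rw [eval_eq', plen, Finset.mul_sum]
  refine (norm_sum_le _ _).trans (Finset.sum_le_sum fun v hv => ?_)
  have h : ‖∏ i, x i ^ v i‖ ≤ B ^ n := by
    rw [norm_prod, ← sum_eq_of_mem_support hP hv, ← Fin.sum_univ_three (f := fun i => v i),
      ← Finset.prod_pow_eq_pow_sum]
    refine Finset.prod_le_prod (fun i _ => norm_nonneg _) fun i _ => ?_
    rw [norm_pow]
    exact pow_le_pow_left₀ (norm_nonneg _) (hB i) _
  rw [norm_mul, mul_comm]
  exact mul_le_mul_of_nonneg_right h (norm_nonneg _)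

/-- A polynomial of degree `N` splits along the `m`-th powers of the variables, without increase
of length, as soon as `N` is large enough for every monomial to be divisible by one of them. -/
lemma exists_split_X_pow {Q : MvPolynomial (Fin 3) ℂ} {N m K : ℕ} (hQ : Q.IsHomogeneous N)
    (hN : N = m + K) (hm : 3 * m ≤ N + 2) :
    ∃ P : Fin 3 → MvPolynomial (Fin 3) ℂ, (∀ j, (P j).IsHomogeneous K) ∧
      Q = ∑ j, X j ^ m * P j ∧ ∑ j, plen (P j) ≤ plen Q := by
  classical
  have hex : ∀ v : Fin 3 →₀ ℕ, ∃ j : Fin 3, v ∈ Q.support → m ≤ v j := by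
    intro v
    by_contra! hcon
    have h0 := hcon 0
    have h1 := hcon 1
    have h2 := hcon 2
    have := sum_eq_of_mem_support hQ h0.1
    omega
  choose j hj using hex
  have hle : ∀ v ∈ Q.support, Finsupp.single (j v) m ≤ v := fun v hv => by
    rw [Finsupp.single_le_iff]; exact hj v hv
  let f : Fin 3 → (Fin 3 →₀ ℕ) → MvPolynomial (Fin 3) ℂ := fun i v =>
    if j v = i then monomial (v - Finsupp.single i m) (Q.coeff v) else 0
  refine ⟨fun i => ∑ v ∈ Q.support, f i v, fun i => ?_, ?_, ?_⟩
  · refine IsHomogeneous.sum _ _ _ fun v hv => ?_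
    by_cases h : j v = i
    · simp only [f, if_pos h]
      subst h
      refine isHomogeneous_monomial _ ?_
      have h1 := congrArg Finsupp.degree (tsub_add_cancel_of_le (hle v hv))
      rw [map_add, Finsupp.degree_single, degree_fin_three v, sum_eq_of_mem_support hQ hv] at h1
      omega
    · simpa only [f, if_neg h] using isHomogeneous_zero _ _ _
  · simp only [Finset.mul_sum]
    rw [Finset.sum_comm]
    conv_lhs => rw [Q.as_sum]
    refine Finset.sum_congr rfl fun v hv => ?_
    rw [Finset.sum_eq_single (j v) (fun i _ hi => by simp [f, hi.symm]) (by simp)]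
    simp only [f, if_pos, X_pow_eq_monomial, monomial_mul, one_mul]
    rw [add_tsub_cancel_of_le (hle v hv)]
  · refine (Finset.sum_le_sum fun i _ => plen_sum_le _ _).trans ?_
    rw [Finset.sum_comm, plen]
    refine Finset.sum_le_sum fun v _ => le_of_eq ?_
    rw [Finset.sum_eq_single (j v) (fun i _ hi => by simp [f, hi.symm]) (by simp)]
    simp [f, plen_monomial]

/-! ### The derivation `DD` -/

/-- The map `DD` as a bundled derivation. -/
noncomputable def DDer : Derivation ℂ (MvPolynomial (Fin 3) ℂ) (MvPolynomial (Fin 3) ℂ) :=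
  (X 0 : MvPolynomial (Fin 3) ℂ) • pderiv 1 + (X 2 : MvPolynomial (Fin 3) ℂ) • pderiv 2

lemma DD_eq : DD = ⇑DDer := by
  ext1 P
  simp [DD, DDer]

lemma DDer_X_zero : DDer (X 0) = 0 := by
  simp [DDer, pderiv_X]

lemma DDer_X_one : DDer (X 1) = X 0 := by
  simp [DDer, pderiv_X]

lemma DDer_X_two : DDer (X 2) = X 2 := by
  simp [DDer, pderiv_X]

lemma DDer_C_mul (c : ℂ) (P : MvPolynomial (Fin 3) ℂ) : DDer (C c * P) = C c * DDer P := by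
  rw [← smul_eq_C_mul, ← smul_eq_C_mul, Derivation.map_smul]

lemma DDer_X_zero_pow_mul (n : ℕ) (P : MvPolynomial (Fin 3) ℂ) :
    DDer (X 0 ^ n * P) = X 0 ^ n * DDer P := by
  simp [Derivation.leibniz_pow, DDer_X_zero]

lemma iterate_DDer_X_zero_pow_mul (n i : ℕ) (P : MvPolynomial (Fin 3) ℂ) :
    DDer^[i] (X 0 ^ n * P) = X 0 ^ n * DDer^[i] P := by
  induction i generalizing P with
  | zero => rfl
  | succ i ih => simp only [Function.iterate_succ_apply, DDer_X_zero_pow_mul, ih]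

lemma iterate_DDer_add (i : ℕ) (P Q : MvPolynomial (Fin 3) ℂ) :
    DDer^[i] (P + Q) = DDer^[i] P + DDer^[i] Q :=
  iterate_map_add DDer i P Q

lemma DDer_isHomogeneous {P : MvPolynomial (Fin 3) ℂ} {n : ℕ} (hP : P.IsHomogeneous n) :
    (DDer P).IsHomogeneous n := by
  rw [P.as_sum, map_sum]
  refine IsHomogeneous.sum _ _ _ fun v hv => ?_
  have hs := sum_eq_of_mem_support hP hv
  simp only [DDer, Derivation.add_apply, Derivation.smul_apply, smul_eq_mul, pderiv_monomial]
  have key : ∀ i k : Fin 3,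
      (X k * monomial (v - Finsupp.single i 1) (coeff v P * (v i : ℂ))).IsHomogeneous n := by
    intro i k
    rcases Nat.eq_zero_or_pos (v i) with h | h
    · simpa [h] using isHomogeneous_zero (Fin 3) ℂ n
    · have h1 := congrArg Finsupp.degree
        (tsub_add_cancel_of_le (Finsupp.single_le_iff.mpr h : Finsupp.single i 1 ≤ v))
      rw [map_add, Finsupp.degree_single, degree_fin_three v, hs] at h1
      rw [← h1, add_comm]
      exact (isHomogeneous_X _ _).mul (isHomogeneous_monomial _ rfl)
  exact (key 1 0).add (key 2 2)

lemma plen_DDer_le {P : MvPolynomial (Fin 3) ℂ} {n : ℕ} (hP : P.IsHomogeneous n) :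
    plen (DDer P) ≤ n * plen P := by
  conv_lhs => rw [P.as_sum, map_sum]
  rw [show n * plen P = ∑ v ∈ P.support, n * ‖P.coeff v‖ from Finset.mul_sum _ _ _]
  refine (plen_sum_le _ _).trans (Finset.sum_le_sum fun v hv => ?_)
  have hs : (v 1 + v 2 : ℝ) ≤ n := by
    have := sum_eq_of_mem_support hP hv
    exact_mod_cast (by omega : v 1 + v 2 ≤ n)
  have key : ∀ i k : Fin 3,
      plen (X k * monomial (v - Finsupp.single i 1) (coeff v P * (v i : ℂ)))
        ≤ ‖coeff v P‖ * v i := by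
    intro i k
    have := plen_X_pow_mul_le k 1 (monomial (v - Finsupp.single i 1) (coeff v P * (v i : ℂ)))
    simpa [plen_monomial] using this
  simp only [DDer, Derivation.add_apply, Derivation.smul_apply, smul_eq_mul, pderiv_monomial]
  calc _ ≤ ‖coeff v P‖ * v 1 + ‖coeff v P‖ * v 2 :=
        (plen_add_le _ _).trans (add_le_add (key 1 0) (key 2 2))
    _ = (v 1 + v 2) * ‖coeff v P‖ := by ring
    _ ≤ n * ‖coeff v P‖ := mul_le_mul_of_nonneg_right hs (norm_nonneg _)

/-! ### Vanishing along the one-parameter subgroup -/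

lemma eval_iterate_DDer_mul {x : Fin 3 → ℂ} {T : ℕ} {P : MvPolynomial (Fin 3) ℂ}
    (hP : ∀ i < T, eval x (DDer^[i] P) = 0) (R : MvPolynomial (Fin 3) ℂ) {i : ℕ} (hi : i < T) :
    eval x (DDer^[i] (R * P)) = 0 := by
  induction i generalizing P R T with
  | zero => simp [show eval x P = 0 from hP 0 hi]
  | succ i ih =>
    rw [Function.iterate_succ_apply, Derivation.leibniz, iterate_DDer_add, map_add, smul_eq_mul,
      smul_eq_mul, mul_comm P]
    have h1 := ih (T := T - 1) (P := DDer P)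
      (fun k hk => by simpa using hP (k + 1) (by omega)) R (by omega)
    rw [h1, ih hP _ (by omega), add_zero]

/-- The ideal of the polynomials that vanish to order `T` at `x` along `DD`. -/
noncomputable def jetIdeal (x : Fin 3 → ℂ) (T : ℕ) : Ideal (MvPolynomial (Fin 3) ℂ) where
  carrier := {P | ∀ i < T, eval x (DDer^[i] P) = 0}
  add_mem' hP hQ i hi := by rw [iterate_DDer_add, map_add, hP i hi, hQ i hi, add_zero]
  zero_mem' i _ := by rw [iterate_map_zero, map_zero]
  smul_mem' R _ hP _ hi := eval_iterate_DDer_mul hP R hi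

lemma mem_jetIdeal {x : Fin 3 → ℂ} {T : ℕ} {P : MvPolynomial (Fin 3) ℂ} :
    P ∈ jetIdeal x T ↔ ∀ i < T, eval x (DDer^[i] P) = 0 := Iff.rfl

lemma Igam_le_jetIdeal (ξ η : ℂ) (T : ℕ) : Igam ξ η T ≤ jetIdeal ![1, ξ, η] T := by
  refine Ideal.span_le.mpr fun P hP => ?_
  rw [SetLike.mem_coe, mem_jetIdeal, ← DD_eq]
  exact hP.2

lemma mem_Igam_of_mem_jetIdeal {ξ η : ℂ} {T d : ℕ} {P : MvPolynomial (Fin 3) ℂ}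
    (hd : P.IsHomogeneous d) (hP : P ∈ jetIdeal ![1, ξ, η] T) : P ∈ Igam ξ η T :=
  Ideal.subset_span ⟨⟨d, hd⟩, by rw [DD_eq]; exact hP⟩

lemma mem_jetIdeal_of_X_zero_pow_mul {x : Fin 3 → ℂ} (hx : x 0 = 1) {T n : ℕ}
    {P : MvPolynomial (Fin 3) ℂ} (h : X 0 ^ n * P ∈ jetIdeal x T) :
    P ∈ jetIdeal x T := by
  intro i hi
  simpa [iterate_DDer_X_zero_pow_mul, hx] using h i hi

/-! ### Newton interpolation by exponential polynomials -/

/-- The operator `∏ s < r, (DD - t s)`. -/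
noncomputable def newtonOp (t : ℕ → ℕ) :
    ℕ → MvPolynomial (Fin 3) ℂ → MvPolynomial (Fin 3) ℂ
  | 0, P => P
  | r + 1, P => DDer (newtonOp t r P) - C (t r : ℂ) * newtonOp t r P

lemma newtonOp_sub (t : ℕ → ℕ) (r : ℕ) (P Q : MvPolynomial (Fin 3) ℂ) :
    newtonOp t r (P - Q) = newtonOp t r P - newtonOp t r Q := by
  induction r with
  | zero => rfl
  | succ r ih => simp only [newtonOp, ih, map_sub]; ring

lemma newtonOp_C_mul (t : ℕ → ℕ) (r : ℕ) (c : ℂ) (P : MvPolynomial (Fin 3) ℂ) :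
    newtonOp t r (C c * P) = C c * newtonOp t r P := by
  induction r with
  | zero => rfl
  | succ r ih => simp only [newtonOp, ih, DDer_C_mul]; ring

lemma newtonOp_sum (t : ℕ → ℕ) (r : ℕ) {ι : Type*} (s : Finset ι)
    (f : ι → MvPolynomial (Fin 3) ℂ) :
    newtonOp t r (∑ i ∈ s, f i) = ∑ i ∈ s, newtonOp t r (f i) := by
  induction r with
  | zero => rfl
  | succ r ih => simp only [newtonOp, ih, map_sum, Finset.mul_sum, Finset.sum_sub_distrib]

lemma newtonOp_isHomogeneous (t : ℕ → ℕ) (r : ℕ) {P : MvPolynomial (Fin 3) ℂ} {n : ℕ}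
    (hP : P.IsHomogeneous n) : (newtonOp t r P).IsHomogeneous n := by
  induction r with
  | zero => exact hP
  | succ r ih => exact (DDer_isHomogeneous ih).sub (ih.C_mul _)

lemma plen_newtonOp_le {t : ℕ → ℕ} {n : ℕ} (ht : ∀ i, t i ≤ n) (r : ℕ)
    {P : MvPolynomial (Fin 3) ℂ} (hP : P.IsHomogeneous n) :
    plen (newtonOp t r P) ≤ (2 * n : ℝ) ^ r * plen P := by
  induction r with
  | zero => simp [newtonOp]
  | succ r ih =>
    have h1 := plen_DDer_le (newtonOp_isHomogeneous t r hP)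
    have h2 := plen_C_mul_le (t r : ℂ) (newtonOp t r P)
    have h3 : (t r : ℝ) ≤ n := by exact_mod_cast ht r
    have h4 := mul_le_mul_of_nonneg_right h3 (plen_nonneg (newtonOp t r P))
    rw [Complex.norm_natCast] at h2
    calc plen (newtonOp t (r + 1) P) ≤ 2 * n * plen (newtonOp t r P) := by
          refine (plen_sub_le _ _).trans ?_
          linarith
      _ ≤ 2 * n * ((2 * n : ℝ) ^ r * plen P) := by gcongr
      _ = _ := by ring

/-- Vanishing of the first `T` Newton functionals implies vanishing to order `T`. -/
lemma mem_jetIdeal_of_newtonOp {x : Fin 3 → ℂ} {t : ℕ → ℕ} {T : ℕ}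
    {P : MvPolynomial (Fin 3) ℂ} (h : ∀ q < T, eval x (newtonOp t q P) = 0) :
    P ∈ jetIdeal x T := by
  have key : ∀ i q, i + q < T → eval x (DDer^[i] (newtonOp t q P)) = 0 := by
    intro i
    induction i with
    | zero => intro q hq; exact h q (by omega)
    | succ i ih =>
      intro q hq
      have h1 : DDer (newtonOp t q P) = newtonOp t (q + 1) P + (t q : ℂ) • newtonOp t q P := by
        rw [newtonOp, smul_eq_C_mul]; ring
      have h2 : DDer^[i] ((t q : ℂ) • newtonOp t q P) = (t q : ℂ) • DDer^[i] (newtonOp t q P) :=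
        (show Function.Commute (⇑DDer) ((t q : ℂ) • ·) from fun P => DDer.map_smul _ P).iterate_left
          i _
      rw [Function.iterate_succ_apply, h1, iterate_DDer_add, h2, map_add, smul_eval,
        ih _ (by omega), ih _ (by omega), mul_zero, add_zero]
  exact fun i hi => key i 0 hi

/-- The form of degree `d` restricting to `z ^ k / k! * exp (j * z)` on the translate of the
one-parameter subgroup by `(ξ, η)`. -/
noncomputable def expMono (ξ η : ℂ) (d j k : ℕ) : MvPolynomial (Fin 3) ℂ :=
  C ((k.factorial : ℂ)⁻¹ * η⁻¹ ^ j) * (X 0 ^ (d - j - k) * (X 1 - C ξ * X 0) ^ k * X 2 ^ j)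

section ExpMono

variable (ξ η : ℂ)

lemma expMono_isHomogeneous {d j k : ℕ} (h : j + k ≤ d) :
    (expMono ξ η d j k).IsHomogeneous d := by
  have h1 : (X 1 - C ξ * X 0 : MvPolynomial (Fin 3) ℂ).IsHomogeneous 1 :=
    (isHomogeneous_X _ _).sub ((isHomogeneous_X _ _).C_mul _)
  have h2 := (((isHomogeneous_X_pow (R := ℂ) (0 : Fin 3) (d - j - k)).mul (h1.pow k)).mul
    (isHomogeneous_X_pow (2 : Fin 3) j)).C_mul ((k.factorial : ℂ)⁻¹ * η⁻¹ ^ j)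
  rwa [show d - j - k + 1 * k + j = d by omega] at h2

lemma DDer_expMono_zero (d j : ℕ) :
    DDer (expMono ξ η d j 0) - C (j : ℂ) * expMono ξ η d j 0 = 0 := by
  rw [expMono, DDer_C_mul]
  rcases j with _ | j
  · simp [Derivation.leibniz_pow, DDer_X_zero]
  · simp [Derivation.leibniz_pow, DDer_X_zero, DDer_X_two]
    ring

lemma DDer_expMono_succ {d j k : ℕ} (h : j + (k + 1) ≤ d) :
    DDer (expMono ξ η d j (k + 1)) - C (j : ℂ) * expMono ξ η d j (k + 1) = expMono ξ η d j k := by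
  have hlin : DDer (X 1 - C ξ * X 0) = X 0 := by
    rw [map_sub, DDer_C_mul, DDer_X_one, DDer_X_zero, mul_zero, sub_zero]
  have hX2 : DDer (X 2 ^ j) = C (j : ℂ) * X 2 ^ j := by
    rcases j with _ | j
    · simp
    · rw [Derivation.leibniz_pow, DDer_X_two, Nat.add_sub_cancel, smul_eq_mul, nsmul_eq_mul,
        map_natCast, pow_succ]
  have hfac : C ((k.factorial : ℂ)⁻¹) =
      C (((k + 1).factorial : ℂ)⁻¹) * (C ((k : ℂ) + 1) : MvPolynomial (Fin 3) ℂ) := by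
    rw [← C_mul]
    congr 1
    have : (k : ℂ) + 1 ≠ 0 := by exact_mod_cast k.succ_ne_zero
    rw [Nat.factorial_succ]
    push_cast
    field_simp
  have hd : d - j - k = d - j - (k + 1) + 1 := by omega
  rw [expMono, expMono, DDer_C_mul, mul_assoc (X 0 ^ _), DDer_X_zero_pow_mul, Derivation.leibniz, hX2,
    Derivation.leibniz_pow, hlin, hd, C_mul, C_mul, hfac]
  simp only [smul_eq_mul, nsmul_eq_mul, Nat.add_sub_cancel, C_add, map_natCast, C_1]
  push_cast
  ring

lemma eval_expMono_zero (hη : η ≠ 0) (d j : ℕ) : eval ![1, ξ, η] (expMono ξ η d j 0) = 1 := by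
  simp [expMono, hη]

lemma eval_expMono_succ (d j k : ℕ) : eval ![1, ξ, η] (expMono ξ η d j (k + 1)) = 0 := by
  simp [expMono]

lemma plen_expMono_le {d j k : ℕ} (h : j + k ≤ d) :
    plen (expMono ξ η d j k) ≤ (2 + ‖ξ‖ + ‖η‖⁻¹) ^ d := by
  have hη : 0 ≤ ‖η‖⁻¹ := by positivity
  have hξ : 0 ≤ ‖ξ‖ := by positivity
  have h1 : plen (X 1 - C ξ * X 0) ≤ 2 + ‖ξ‖ + ‖η‖⁻¹ := by
    have := (plen_sub_le (X 1) (C ξ * X 0)).trans (add_le_add_right (plen_C_mul_le ξ (X 0)) _)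
    rw [plen_X, plen_X] at this
    linarith
  have h2 : plen (X 0 ^ (d - j - k) * (X 1 - C ξ * X 0) ^ k * X 2 ^ j)
      ≤ (2 + ‖ξ‖ + ‖η‖⁻¹) ^ k := by
    rw [mul_comm]
    refine (plen_X_pow_mul_le _ _ _).trans ((plen_X_pow_mul_le _ _ _).trans ?_)
    exact (plen_pow_le _ _).trans (pow_le_pow_left₀ (plen_nonneg _) h1 k)
  have h3 : ‖(k.factorial : ℂ)⁻¹ * η⁻¹ ^ j‖ ≤ (2 + ‖ξ‖ + ‖η‖⁻¹) ^ j := by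
    rw [norm_mul, norm_inv, Complex.norm_natCast, norm_pow, norm_inv]
    have hf : ((k.factorial : ℝ))⁻¹ ≤ 1 :=
      inv_le_one_of_one_le₀ (by exact_mod_cast k.factorial_pos)
    refine (mul_le_of_le_one_left (by positivity) hf).trans (pow_le_pow_left₀ hη ?_ j)
    linarith
  calc plen (expMono ξ η d j k) ≤ (2 + ‖ξ‖ + ‖η‖⁻¹) ^ j * (2 + ‖ξ‖ + ‖η‖⁻¹) ^ k :=
        (plen_C_mul_le _ _).trans (mul_le_mul h3 h2 (plen_nonneg _) (by positivity))
    _ = (2 + ‖ξ‖ + ‖η‖⁻¹) ^ (j + k) := (pow_add _ _ _).symm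
    _ ≤ _ := pow_le_pow_right₀ (by linarith) h

end ExpMono

/-- The form of degree `d` restricting to the divided difference of `u ↦ exp (u * z)` at the
nodes `t i, …, t (i + n)`, which are assumed to be sorted. -/
noncomputable def divDiff (ξ η : ℂ) (d : ℕ) (t : ℕ → ℕ) : ℕ → ℕ → MvPolynomial (Fin 3) ℂ
  | i, 0 => expMono ξ η d (t i) 0
  | i, n + 1 =>
    if t (i + n + 1) = t i then expMono ξ η d (t i) (n + 1)
    else C (((t (i + n + 1) : ℂ) - t i)⁻¹) *
      (divDiff ξ η d t (i + 1) n - divDiff ξ η d t i n)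

section DivDiff

variable {ξ η : ℂ} {d T : ℕ} {t : ℕ → ℕ}

lemma divDiff_of_eq {i n : ℕ} (h : t (i + n) = t i) :
    divDiff ξ η d t i n = expMono ξ η d (t i) n := by
  cases n with
  | zero => rfl
  | succ n => rw [divDiff, if_pos (by simpa [add_assoc] using h)]

lemma divDiff_isHomogeneous (hT : ∀ i n, i + n < T → t (i + n) = t i → t i + n ≤ d) {i n : ℕ}
    (h : i + n < T) : (divDiff ξ η d t i n).IsHomogeneous d := by
  induction n generalizing i with
  | zero => exact expMono_isHomogeneous _ _ (hT i 0 h rfl)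
  | succ n ih =>
    rw [divDiff]
    split_ifs with he
    · exact expMono_isHomogeneous _ _ (hT i (n + 1) h he)
    · exact ((ih (by omega)).sub (ih (by omega))).C_mul _

lemma plen_divDiff_le (hT : ∀ i n, i + n < T → t (i + n) = t i → t i + n ≤ d) {i n : ℕ}
    (h : i + n < T) : plen (divDiff ξ η d t i n) ≤ 2 ^ n * (2 + ‖ξ‖ + ‖η‖⁻¹) ^ d := by
  induction n generalizing i with
  | zero => simpa [divDiff] using plen_expMono_le ξ η (hT i 0 h rfl)
  | succ n ih =>
    rw [divDiff]
    split_ifs with he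
    · refine (plen_expMono_le ξ η (hT i (n + 1) h he)).trans ?_
      exact le_mul_of_one_le_left (by positivity) (one_le_pow₀ (by norm_num))
    · have h1 : ‖((t (i + n + 1) : ℂ) - t i)⁻¹‖ ≤ 1 := by
        rw [norm_inv]
        refine inv_le_one_of_one_le₀ ?_
        have h2 : (1 : ℤ) ≤ |(t (i + n + 1) : ℤ) - t i| := Int.one_le_abs (by omega)
        have h3 : ((t (i + n + 1) : ℂ) - t i) = (((t (i + n + 1) : ℤ) - t i : ℤ) : ℂ) := by
          push_cast; rfl
        rw [h3, Complex.norm_intCast]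
        exact_mod_cast h2
      refine (plen_C_mul_le _ _).trans ((mul_le_of_le_one_left (plen_nonneg _) h1).trans ?_)
      refine (plen_sub_le _ _).trans ((add_le_add (ih (by omega)) (ih (by omega))).trans ?_)
      exact le_of_eq (by ring)

/-- Removing the first or the last node of a divided difference. -/
lemma DDer_divDiff (ht : Antitone t)
    (hT : ∀ i n, i + n < T → t (i + n) = t i → t i + n ≤ d) {i n : ℕ} (h : i + (n + 1) < T) :
    DDer (divDiff ξ η d t i (n + 1)) - C (t i : ℂ) * divDiff ξ η d t i (n + 1) =
        divDiff ξ η d t (i + 1) n ∧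
      DDer (divDiff ξ η d t i (n + 1)) - C (t (i + n + 1) : ℂ) * divDiff ξ η d t i (n + 1) =
        divDiff ξ η d t i n := by
  induction n generalizing i with
  | zero =>
    by_cases he : t (i + 0 + 1) = t i
    · have h0 : divDiff ξ η d t i (0 + 1) = expMono ξ η d (t i) (0 + 1) := divDiff_of_eq he
      have he' : t (i + 1) = t i := he
      rw [h0, he, DDer_expMono_succ ξ η (hT i 1 h he)]
      simp [divDiff, he']
    · have hne : ((t (i + 0 + 1) : ℂ) - t i) ≠ 0 := by
        rw [sub_ne_zero]; exact_mod_cast he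
      have hC : C ((t (i + 0 + 1) : ℂ) - t i)⁻¹ * (C (t (i + 0 + 1) : ℂ) - C (t i : ℂ)) =
          (1 : MvPolynomial (Fin 3) ℂ) := by
        rw [← C_sub, ← C_mul, inv_mul_cancel₀ hne, C_1]
      have hi := DDer_expMono_zero ξ η d (t i)
      have hj := DDer_expMono_zero ξ η d (t (i + 0 + 1))
      simp only [divDiff, if_neg he, DDer_C_mul, map_sub, add_zero] at *
      constructor
      · linear_combination C ((t (i + 1) : ℂ) - t i)⁻¹ * (hj - hi) +
          expMono ξ η d (t (i + 1)) 0 * hC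
      · linear_combination C ((t (i + 1) : ℂ) - t i)⁻¹ * (hj - hi) +
          expMono ξ η d (t i) 0 * hC
  | succ n ih =>
    by_cases he : t (i + (n + 1) + 1) = t i
    · have h0 : divDiff ξ η d t i (n + 1 + 1) = expMono ξ η d (t i) (n + 1 + 1) :=
        divDiff_of_eq he
      have ha : t (i + 1) = t i :=
        le_antisymm (ht (by omega)) (he ▸ ht (by omega))
      have hb : t (i + (n + 1)) = t i :=
        le_antisymm (ht (by omega)) (he ▸ ht (by omega))
      have hc : t (i + 1 + (n + 1)) = t (i + 1) := by
        rw [ha, ← he]; congr 1; omega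
      rw [h0, he, DDer_expMono_succ ξ η (hT i (n + 1 + 1) h he), divDiff_of_eq hb,
        divDiff_of_eq hc, ha]
      exact ⟨rfl, rfl⟩
    · have hne : ((t (i + (n + 1) + 1) : ℂ) - t i) ≠ 0 := by
        rw [sub_ne_zero]; exact_mod_cast he
      have hC : C ((t (i + (n + 1) + 1) : ℂ) - t i)⁻¹ *
          (C (t (i + (n + 1) + 1) : ℂ) - C (t i : ℂ)) = (1 : MvPolynomial (Fin 3) ℂ) := by
        rw [← C_sub, ← C_mul, inv_mul_cancel₀ hne, C_1]
      have hi := (ih (i := i) (by omega)).1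
      have hj := (ih (i := i + 1) (by omega)).2
      rw [show i + 1 + n + 1 = i + (n + 1) + 1 by omega] at hj
      have h0 : divDiff ξ η d t i (n + 1 + 1) = C ((t (i + (n + 1) + 1) : ℂ) - t i)⁻¹ *
          (divDiff ξ η d t (i + 1) (n + 1) - divDiff ξ η d t i (n + 1)) := by
        rw [divDiff, if_neg he]
      rw [h0, DDer_C_mul, map_sub]
      constructor
      · linear_combination C ((t (i + (n + 1) + 1) : ℂ) - t i)⁻¹ * (hj - hi) +
          divDiff ξ η d t (i + 1) (n + 1) * hC
      · linear_combination C ((t (i + (n + 1) + 1) : ℂ) - t i)⁻¹ * (hj - hi) +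
          divDiff ξ η d t i (n + 1) * hC

lemma newtonOp_divDiff (ht : Antitone t)
    (hT : ∀ i n, i + n < T → t (i + n) = t i → t i + n ≤ d) {q n : ℕ} (h : q + n < T) :
    newtonOp t q (divDiff ξ η d t 0 (q + n)) = divDiff ξ η d t q n := by
  induction q generalizing n with
  | zero => simp [newtonOp]
  | succ q ih =>
    rw [newtonOp, show q + 1 + n = q + (n + 1) by omega, ih (by omega)]
    exact (DDer_divDiff ht hT (by omega)).1

lemma newtonOp_divDiff_of_lt (ht : Antitone t)
    (hT : ∀ i n, i + n < T → t (i + n) = t i → t i + n ≤ d) {q r : ℕ} (hr : r < T) (h : r < q) :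
    newtonOp t q (divDiff ξ η d t 0 r) = 0 := by
  induction q, h using Nat.le_induction with
  | base =>
    have h1 := newtonOp_divDiff (ξ := ξ) (η := η) ht hT (q := r) (n := 0) hr
    rw [newtonOp, show divDiff ξ η d t 0 r = divDiff ξ η d t 0 (r + 0) from rfl, h1]
    exact DDer_expMono_zero ξ η d (t r)
  | succ q _ ih => rw [newtonOp, ih]; simp

lemma eval_divDiff_zero (hη : η ≠ 0) (i : ℕ) : eval ![1, ξ, η] (divDiff ξ η d t i 0) = 1 :=
  eval_expMono_zero ξ η hη d (t i)

lemma eval_divDiff_succ (hη : η ≠ 0) (i n : ℕ) :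
    eval ![1, ξ, η] (divDiff ξ η d t i (n + 1)) = 0 := by
  induction n generalizing i with
  | zero =>
    rw [divDiff]
    split_ifs
    · exact eval_expMono_succ ξ η d _ _
    · rw [map_mul, map_sub, eval_divDiff_zero hη, eval_divDiff_zero hη, sub_self, mul_zero]
  | succ n ih =>
    rw [divDiff]
    split_ifs
    · exact eval_expMono_succ ξ η d _ _
    · rw [map_mul, map_sub, ih, ih, sub_self, mul_zero]

/-- Every jet of order `T` at `(1, ξ, η)` is interpolated by a form of degree `d`. -/
lemma exists_interpolation (hη : η ≠ 0) (ht : Antitone t)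
    (hT : ∀ i n, i + n < T → t (i + n) = t i → t i + n ≤ d) {K : ℕ} (hK : 0 < K)
    (htK : ∀ i, t i ≤ K) (hdK : d ≤ K) {P : MvPolynomial (Fin 3) ℂ} (hP : P.IsHomogeneous K) :
    ∃ S : MvPolynomial (Fin 3) ℂ, S.IsHomogeneous d ∧ P - S ∈ jetIdeal ![1, ξ, η] T ∧
      plen S ≤ T * ((2 + ‖ξ‖ + ‖η‖⁻¹) * max 1 (max ‖ξ‖ ‖η‖)) ^ K * (4 * (K : ℝ)) ^ T *
        plen P := by
  set b : ℕ → ℂ := fun r => eval ![1, ξ, η] (newtonOp t r P)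
  have hK1 : (1 : ℝ) ≤ K := by exact_mod_cast hK
  have hη0 : 0 ≤ ‖η‖⁻¹ := by positivity
  have hξ0 : 0 ≤ ‖ξ‖ := norm_nonneg ξ
  have hb : ∀ r, ‖b r‖ ≤ max 1 (max ‖ξ‖ ‖η‖) ^ K * ((2 * K : ℝ) ^ r * plen P) := fun r => by
    refine (norm_eval_le (newtonOp_isHomogeneous t r hP) (B := max 1 (max ‖ξ‖ ‖η‖)) ?_).trans ?_
    · intro i
      fin_cases i <;> simp
    · gcongr
      exact plen_newtonOp_le htK r hP
  refine ⟨∑ r ∈ Finset.range T, C (b r) * divDiff ξ η d t 0 r, ?_, ?_, ?_⟩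
  · refine IsHomogeneous.sum _ _ _ fun r hr => ?_
    exact (divDiff_isHomogeneous hT (by simpa using hr)).C_mul _
  · refine mem_jetIdeal_of_newtonOp (t := t) fun q hq => ?_
    rw [newtonOp_sub, map_sub, newtonOp_sum, map_sum, Finset.sum_eq_single q]
    · have h1 := newtonOp_divDiff (ξ := ξ) (η := η) ht hT (q := q) (n := 0) hq
      rw [add_zero] at h1
      rw [newtonOp_C_mul, h1, map_mul, eval_divDiff_zero hη, eval_C, mul_one, sub_self]
    · intro r hr hrq
      rw [Finset.mem_range] at hr
      rw [newtonOp_C_mul, map_mul]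
      rcases lt_or_gt_of_ne hrq with h | h
      · rw [newtonOp_divDiff_of_lt ht hT hr h, map_zero, mul_zero]
      · obtain ⟨n, rfl⟩ := Nat.exists_eq_add_of_lt h
        rw [add_assoc, newtonOp_divDiff ht hT (by omega), eval_divDiff_succ hη, mul_zero]
    · simp [hq]
  · refine (plen_sum_le _ _).trans ?_
    have hterm : ∀ r ∈ Finset.range T, plen (C (b r) * divDiff ξ η d t 0 r) ≤
        ((2 + ‖ξ‖ + ‖η‖⁻¹) * max 1 (max ‖ξ‖ ‖η‖)) ^ K * (4 * (K : ℝ)) ^ T * plen P := by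
      intro r hr
      rw [Finset.mem_range] at hr
      have h1 := plen_divDiff_le (ξ := ξ) (η := η) hT (i := 0) (n := r) (by omega)
      have h2 : (2 + ‖ξ‖ + ‖η‖⁻¹) ^ d ≤ (2 + ‖ξ‖ + ‖η‖⁻¹) ^ K :=
        pow_le_pow_right₀ (by linarith) hdK
      have h3 : (4 * (K : ℝ)) ^ r ≤ (4 * (K : ℝ)) ^ T :=
        pow_le_pow_right₀ (by linarith) hr.le
      have hP0 := plen_nonneg P
      calc plen (C (b r) * divDiff ξ η d t 0 r)
          ≤ (max 1 (max ‖ξ‖ ‖η‖) ^ K * ((2 * K : ℝ) ^ r * plen P)) *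
              (2 ^ r * (2 + ‖ξ‖ + ‖η‖⁻¹) ^ K) := by
            refine (plen_C_mul_le _ _).trans (mul_le_mul (hb r) ?_ (plen_nonneg _) (by positivity))
            exact h1.trans (by gcongr)
        _ = ((2 + ‖ξ‖ + ‖η‖⁻¹) * max 1 (max ‖ξ‖ ‖η‖)) ^ K * (4 * (K : ℝ)) ^ r * plen P := by
            rw [show (4 * (K : ℝ)) = 2 * K * 2 by ring, mul_pow (2 * (K : ℝ)), mul_pow _ (max _ _)]
            ring
        _ ≤ _ := by gcongr
    refine (Finset.sum_le_card_nsmul _ _ _ hterm).trans (le_of_eq ?_)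
    rw [Finset.card_range, nsmul_eq_mul]
    ring

end DivDiff

/-- A decreasing sequence taking the value `j ≤ L` exactly `L + 1 - j` times before the index
`(L + 2).choose 2`. -/
lemma exists_antitone_nodes (L : ℕ) : ∃ t : ℕ → ℕ, Antitone t ∧ (∀ i, t i ≤ L) ∧
    ∀ i n, i + n < (L + 2).choose 2 → t (i + n) = t i → t i + n ≤ L := by
  have hex : ∀ i : ℕ, ∃ s, i < (s + 2).choose 2 := fun i =>
    ⟨i, by rw [Nat.choose_succ_succ' (i + 1) 1, Nat.choose_one_right]; omega⟩
  classical
  let s : ℕ → ℕ := fun i => Nat.find (hex i)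
  have hs : ∀ i, i < (s i + 2).choose 2 := fun i => Nat.find_spec (hex i)
  have hmin : ∀ {i m}, i < (m + 2).choose 2 → s i ≤ m := fun {i m} h => Nat.find_min' (hex i) h
  refine ⟨fun i => L - s i, fun i j hij => ?_, fun i => Nat.sub_le _ _, fun i n hin he => ?_⟩
  · have := hmin (hij.trans_lt (hs j))
    show L - s j ≤ L - s i
    omega
  · simp only at he ⊢
    have h1 : s (i + n) ≤ L := hmin hin
    have h2 : s i ≤ L := hmin (by omega)
    have h3 : s (i + n) = s i := by omega
    have h4 := hs (i + n)
    rw [h3] at h4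
    rcases Nat.eq_zero_or_pos (s i) with h0 | h0
    · rw [h0] at h4
      simp at h4
      omega
    · obtain ⟨m, hm⟩ := Nat.exists_eq_add_of_le' h0
      have h5 : (m + 2).choose 2 ≤ i := by
        by_contra! h
        have := hmin h
        omega
      rw [hm, Nat.choose_succ_succ' (m + 1 + 1) 1, Nat.choose_one_right] at h4
      simp only [Nat.reduceAdd] at h4
      have : m + 1 + 1 = m + 2 := rfl
      rw [this] at h4
      omega

theorem stmt5 (ξ η : ℂ) (hη : η ≠ 0) (K L N T : ℕ)
    (h1 : Nat.choose (L + 1) 2 < T) (h2 : T ≤ Nat.choose (L + 2) 2)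
    (h3 : L < K) (h4 : K ≤ N) (h5 : N + L ≤ 2 * K) (h6 : 2 * N ≤ 3 * K + 2)
    (Q : MvPolynomial (Fin 3) ℂ) (hQ : Q ∈ Igam ξ η T) (hQh : Q.IsHomogeneous N) :
    ∃ Q₀ Q₁ Q₂ : MvPolynomial (Fin 3) ℂ,
      (Q₀ ∈ Igam ξ η T ∧ Q₀.IsHomogeneous K) ∧
      (Q₁ ∈ Igam ξ η T ∧ Q₁.IsHomogeneous K) ∧
      (Q₂ ∈ Igam ξ η T ∧ Q₂.IsHomogeneous K) ∧
      Q = X 0 ^ (N - K) * Q₀ + X 1 ^ (N - K) * Q₁ + X 2 ^ (N - K) * Q₂ ∧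
      plen Q₀ + plen Q₁ + plen Q₂ ≤
        ((2 + ‖ξ‖ + ‖η‖⁻¹) * max 1 (max ‖ξ‖ ‖η‖)) ^ K * (64 * (K : ℝ)) ^ T * plen Q := by
  obtain ⟨t, hta, htL, htT⟩ := exists_antitone_nodes L
  have hT : ∀ i n, i + n < T → t (i + n) = t i → t i + n ≤ 2 * K - N := fun i n hi he =>
    (htT i n (hi.trans_le h2) he).trans (by omega)
  obtain ⟨P, hPh, hPsum, hPlen⟩ := exists_split_X_pow (m := N - K) (K := K) hQh (by omega) (by omega)
  rw [Fin.sum_univ_three] at hPsum hPlen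
  have interp := fun j => exists_interpolation (ξ := ξ) hη hta hT (K := K) (by omega)
    (fun i => (htL i).trans h3.le) (by omega) (hPh j)
  obtain ⟨S₁, hS₁h, hS₁, hS₁len⟩ := interp 1
  obtain ⟨S₂, hS₂h, hS₂, hS₂len⟩ := interp 2
  have homog : ∀ (j : Fin 3) {S : MvPolynomial (Fin 3) ℂ}, S.IsHomogeneous (2 * K - N) →
      (X j ^ (N - K) * S).IsHomogeneous K := by
    intro j S hS
    have := (isHomogeneous_X_pow (R := ℂ) j (N - K)).mul hS
    rwa [show N - K + (2 * K - N) = K by omega] at this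
  have vanish : ∀ {P S : MvPolynomial (Fin 3) ℂ}, P - S ∈ jetIdeal ![1, ξ, η] T →
      P - X 0 ^ (N - K) * S ∈ jetIdeal ![1, ξ, η] T := by
    intro P S h i hi
    have := h i hi
    rw [iterate_map_sub, map_sub] at this
    rw [iterate_map_sub, iterate_DDer_X_zero_pow_mul]
    simpa using this
  have hQ₁ := vanish hS₁
  have hQ₂ := vanish hS₂
  have hsum : Q = X 0 ^ (N - K) * (P 0 + X 1 ^ (N - K) * S₁ + X 2 ^ (N - K) * S₂) +
      X 1 ^ (N - K) * (P 1 - X 0 ^ (N - K) * S₁) + X 2 ^ (N - K) * (P 2 - X 0 ^ (N - K) * S₂) := by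
    rw [hPsum]; ring
  have hQ₀ : P 0 + X 1 ^ (N - K) * S₁ + X 2 ^ (N - K) * S₂ ∈ jetIdeal ![1, ξ, η] T := by
    refine mem_jetIdeal_of_X_zero_pow_mul (n := N - K) rfl ?_
    have := sub_mem (sub_mem (Igam_le_jetIdeal ξ η T hQ)
      (Ideal.mul_mem_left _ (X 1 ^ (N - K)) hQ₁)) (Ideal.mul_mem_left _ (X 2 ^ (N - K)) hQ₂)
    convert this using 1
    rw [hPsum]; ring
  have hh₀ := ((hPh 0).add (homog 1 hS₁h)).add (homog 2 hS₂h)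
  have hh₁ := (hPh 1).sub (homog 0 hS₁h)
  have hh₂ := (hPh 2).sub (homog 0 hS₂h)
  refine ⟨_, _, _, ⟨mem_Igam_of_mem_jetIdeal hh₀ hQ₀, hh₀⟩,
    ⟨mem_Igam_of_mem_jetIdeal hh₁ hQ₁, hh₁⟩, ⟨mem_Igam_of_mem_jetIdeal hh₂ hQ₂, hh₂⟩,
    hsum, ?_⟩
  have hlen : plen (P 0 + X 1 ^ (N - K) * S₁ + X 2 ^ (N - K) * S₂) +
      plen (P 1 - X 0 ^ (N - K) * S₁) + plen (P 2 - X 0 ^ (N - K) * S₂) ≤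
      plen Q + 2 * (plen S₁ + plen S₂) := by
    have a := plen_add_le (P 0 + X 1 ^ (N - K) * S₁) (X 2 ^ (N - K) * S₂)
    have b := plen_add_le (P 0) (X 1 ^ (N - K) * S₁)
    have c := plen_sub_le (P 1) (X 0 ^ (N - K) * S₁)
    have e := plen_sub_le (P 2) (X 0 ^ (N - K) * S₂)
    have := plen_X_pow_mul_le 2 (N - K) S₂
    have := plen_X_pow_mul_le 1 (N - K) S₁
    have := plen_X_pow_mul_le 0 (N - K) S₁
    have := plen_X_pow_mul_le 0 (N - K) S₂
    linarith
  have hK1 : (1 : ℝ) ≤ K := by exact_mod_cast (by omega : 1 ≤ K)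
  have hη0 : 0 ≤ ‖η‖⁻¹ := by positivity
  have hξ0 : 0 ≤ ‖ξ‖ := norm_nonneg ξ
  set c : ℝ := ((2 + ‖ξ‖ + ‖η‖⁻¹) * max 1 (max ‖ξ‖ ‖η‖)) ^ K with hc
  have hc1 : 1 ≤ c :=
    one_le_pow₀ (one_le_mul_of_one_le_of_one_le (by linarith) (le_max_left _ _))
  have hA1 : 1 ≤ c * (4 * (K : ℝ)) ^ T :=
    one_le_mul_of_one_le_of_one_le hc1 (one_le_pow₀ (by linarith))
  have hT16 : (1 + 2 * T : ℝ) ≤ 16 ^ T := by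
    have := one_add_mul_le_pow (a := (15 : ℝ)) (by norm_num) T
    norm_num at this
    linarith [(Nat.cast_nonneg T : (0 : ℝ) ≤ T)]
  have hP12 : plen S₁ + plen S₂ ≤ T * (c * (4 * (K : ℝ)) ^ T) * plen Q := by
    calc plen S₁ + plen S₂ ≤ T * (c * (4 * (K : ℝ)) ^ T) * (plen (P 1) + plen (P 2)) := by
          linarith
      _ ≤ _ := by
          gcongr
          linarith [plen_nonneg (P 0)]
  have hQ0 := plen_nonneg Q
  calc _ ≤ plen Q + 2 * (T * (c * (4 * (K : ℝ)) ^ T) * plen Q) := by linarith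
    _ ≤ (c * (4 * (K : ℝ)) ^ T) * plen Q + 2 * (T * (c * (4 * (K : ℝ)) ^ T) * plen Q) := by
        gcongr
        exact le_mul_of_one_le_left hQ0 hA1
    _ = (1 + 2 * T) * (c * (4 * (K : ℝ)) ^ T) * plen Q := by ring
    _ ≤ 16 ^ T * (c * (4 * (K : ℝ)) ^ T) * plen Q := by gcongr
    _ = _ := by
        rw [show (64 * (K : ℝ)) = 16 * (4 * K) by ring, mul_pow 16]
        ring
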